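/- Let k be an algebraically closed field of characteristic zero and let f = a·x² + b·xy + c·yx + d·y² + α·xz + β·yz + γ·z² be a homogeneous degree-two element of the free algebra k⟨x,y,z⟩ with a, b, c, d, α, β, γ ∈ k and (a,b,c,d) ≠ (0,0,0,0) (i.e. f ∉ k[z]). Then the homogenization H = k⟨x,y,z | xz − zx, yz − zy, f⟩ is isomorphic as a k-algebra to k⟨x,y,z | xz − zx, yz − zy, g⟩ where g is one of the following: xy − q·yx for some q ∈ k^×; xy − q·yx − z² for some q ∈ k^×; yx − xy + y²; yx − xy + y² + z²; yx − xy + yz; yx − xy + y² + xz; x²; x² − z²; yx; yx − z²; or x² + yz. -/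

import Mathlib

noncomputable section

/-- The generator `x` of the free algebra `k⟨x,y,z⟩`. -/
def X (k : Type*) [Field k] : FreeAlgebra k (Fin 3) := FreeAlgebra.ι k 0

/-- The generator `y` of the free algebra `k⟨x,y,z⟩`. -/
def Y (k : Type*) [Field k] : FreeAlgebra k (Fin 3) := FreeAlgebra.ι k 1

/-- The generator `z` of the free algebra `k⟨x,y,z⟩`. -/
def Z (k : Type*) [Field k] : FreeAlgebra k (Fin 3) := FreeAlgebra.ι k 2

/-- The relations identifying `xz - zx`, `yz - zy`, and `f` with `0`. -/
def hrel (k : Type*) [Field k] (f : FreeAlgebra k (Fin 3)) :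
    FreeAlgebra k (Fin 3) → FreeAlgebra k (Fin 3) → Prop :=
  fun u v => (u = X k * Z k - Z k * X k ∧ v = 0) ∨
    (u = Y k * Z k - Z k * Y k ∧ v = 0) ∨ (u = f ∧ v = 0)

/-- `k⟨x, y, z | xz - zx, yz - zy, f⟩`: the free algebra on `x, y, z` modulo the
two-sided ideal generated by `xz - zx`, `yz - zy`, and `f`. -/
abbrev HAlg (k : Type*) [Field k] (f : FreeAlgebra k (Fin 3)) := RingQuot (hrel k f)

/-- Evaluate the quadratic form with given coefficients in an algebra. -/
def Ev {k A : Type*} [Field k] [Ring A] [Algebra k A] (x y z : A) (a b c d α β γ : k) : A :=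
  a • (x * x) + b • (x * y) + c • (y * x) + d • (y * y)
      + α • (x * z) + β • (y * z) + γ • (z * z)

theorem Ev_subst {k A : Type*} [Field k] [Ring A] [Algebra k A] (x y z : A)
    (hx : z * x = x * z) (hy : z * y = y * z)
    (p q r s t u w l : k) {a b c d α β γ a' b' c' d' α' β' γ' : k}
    (h1 : l * a' = a*p*p + b*p*s + c*s*p + d*s*s)
    (h2 : l * b' = a*p*q + b*p*t + c*s*q + d*s*t)
    (h3 : l * c' = a*q*p + b*q*s + c*t*p + d*t*s)
    (h4 : l * d' = a*q*q + b*q*t + c*t*q + d*t*t)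
    (h5 : l * α' = 2*a*p*r + (b+c)*(p*u + s*r) + 2*d*s*u + w*(α*p + β*s))
    (h6 : l * β' = 2*a*q*r + (b+c)*(q*u + t*r) + 2*d*t*u + w*(α*q + β*t))
    (h7 : l * γ' = a*r*r + (b+c)*r*u + d*u*u + w*(α*r + β*u) + γ*w*w) :
    Ev (p • x + q • y + r • z) (s • x + t • y + u • z) (w • z) a b c d α β γ
      = l • Ev x y z a' b' c' d' α' β' γ' := by
  unfold Ev
  simp only [smul_add, smul_smul, h1, h2, h3, h4, h5, h6, h7]
  simp only [add_mul, mul_add, smul_mul_assoc, mul_smul_comm, hx, hy]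
  module

theorem lift_Ev {k A : Type*} [Field k] [Ring A] [Algebra k A] (φ : FreeAlgebra k (Fin 3) →ₐ[k] A)
    (a b c d α β γ : k) :
    φ (Ev (X k) (Y k) (Z k) a b c d α β γ)
      = Ev (φ (X k)) (φ (Y k)) (φ (Z k)) a b c d α β γ := by
  simp [Ev]

/-- The universal map. -/
def hlift {k A : Type*} [Field k] [Ring A] [Algebra k A] {a b c d α β γ : k} (x y z : A)
    (hx : z * x = x * z) (hy : z * y = y * z) (h : Ev x y z a b c d α β γ = 0) :
    HAlg k (Ev (X k) (Y k) (Z k) a b c d α β γ) →ₐ[k] A :=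
  RingQuot.liftAlgHom k ⟨FreeAlgebra.lift k ![x, y, z], by
    rintro _ _ (⟨rfl, rfl⟩ | ⟨rfl, rfl⟩ | ⟨rfl, rfl⟩)
    · simp [X, Z, hx]
    · simp [Y, Z, hy]
    · rw [lift_Ev]; simpa [X, Y, Z] using h⟩

/-- Quotient map. -/
abbrev mkH (k : Type*) [Field k] (f : FreeAlgebra k (Fin 3)) :
    FreeAlgebra k (Fin 3) →ₐ[k] HAlg k f := RingQuot.mkAlgHom k (hrel k f)

theorem mk_x (k : Type*) [Field k] (f : FreeAlgebra k (Fin 3)) :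
    mkH k f (Z k) * mkH k f (X k) = mkH k f (X k) * mkH k f (Z k) := by
  have := RingQuot.mkAlgHom_rel k (s := hrel k f) (Or.inl ⟨rfl, rfl⟩)
  rw [map_sub, map_zero, map_mul, map_mul, sub_eq_zero] at this
  exact this.symm

theorem mk_y (k : Type*) [Field k] (f : FreeAlgebra k (Fin 3)) :
    mkH k f (Z k) * mkH k f (Y k) = mkH k f (Y k) * mkH k f (Z k) := by
  have := RingQuot.mkAlgHom_rel k (s := hrel k f) (Or.inr (Or.inl ⟨rfl, rfl⟩))
  rw [map_sub, map_zero, map_mul, map_mul, sub_eq_zero] at this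
  exact this.symm

theorem mk_f (k : Type*) [Field k] (f : FreeAlgebra k (Fin 3)) : mkH k f f = 0 := by
  have := RingQuot.mkAlgHom_rel k (s := hrel k f) (Or.inr (Or.inr ⟨rfl, rfl⟩))
  rwa [map_zero] at this

section
variable {k A : Type*} [Field k] [Ring A] [Algebra k A] {a b c d α β γ : k} (x y z : A)
    (hx : z * x = x * z) (hy : z * y = y * z) (h : Ev x y z a b c d α β γ = 0)

theorem hlift_x : hlift x y z hx hy h (mkH k _ (X k)) = x := by
  refine (RingQuot.liftAlgHom_mkAlgHom_apply _ _ _ _).trans ?_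
  simp [X]
theorem hlift_y : hlift x y z hx hy h (mkH k _ (Y k)) = y := by
  refine (RingQuot.liftAlgHom_mkAlgHom_apply _ _ _ _).trans ?_
  simp [Y]
theorem hlift_z : hlift x y z hx hy h (mkH k _ (Z k)) = z := by
  refine (RingQuot.liftAlgHom_mkAlgHom_apply _ _ _ _).trans ?_
  simp [Z]
end

theorem hext {k A : Type*} [Field k] [Ring A] [Algebra k A] {f : FreeAlgebra k (Fin 3)}
    {φ ψ : HAlg k f →ₐ[k] A} (h1 : φ (mkH k f (X k)) = ψ (mkH k f (X k)))
    (h2 : φ (mkH k f (Y k)) = ψ (mkH k f (Y k)))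
    (h3 : φ (mkH k f (Z k)) = ψ (mkH k f (Z k))) : φ = ψ := by
  apply RingQuot.ringQuot_ext'
  apply FreeAlgebra.hom_ext
  funext i
  fin_cases i
  · exact h1
  · exact h2
  · exact h3

theorem iso_subst {k : Type*} [Field k]
    (p q r s t u w l : k) {a b c d α β γ a' b' c' d' α' β' γ' : k}
    (hD : p * t - q * s ≠ 0) (hw : w ≠ 0) (hl : l ≠ 0)
    (h1 : l * a' = a*p*p + b*p*s + c*s*p + d*s*s)
    (h2 : l * b' = a*p*q + b*p*t + c*s*q + d*s*t)
    (h3 : l * c' = a*q*p + b*q*s + c*t*p + d*t*s)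
    (h4 : l * d' = a*q*q + b*q*t + c*t*q + d*t*t)
    (h5 : l * α' = 2*a*p*r + (b+c)*(p*u + s*r) + 2*d*s*u + w*(α*p + β*s))
    (h6 : l * β' = 2*a*q*r + (b+c)*(q*u + t*r) + 2*d*t*u + w*(α*q + β*t))
    (h7 : l * γ' = a*r*r + (b+c)*r*u + d*u*u + w*(α*r + β*u) + γ*w*w) :
    Nonempty (HAlg k (Ev (X k) (Y k) (Z k) a b c d α β γ) ≃ₐ[k]
      HAlg k (Ev (X k) (Y k) (Z k) a' b' c' d' α' β' γ')) := by
  set F := Ev (X k) (Y k) (Z k) a b c d α β γ with hF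
  set G := Ev (X k) (Y k) (Z k) a' b' c' d' α' β' γ' with hG
  have fx := mk_x k F
  have fy := mk_y k F
  have gx := mk_x k G
  have gy := mk_y k G
  have ff : Ev (mkH k F (X k)) (mkH k F (Y k)) (mkH k F (Z k)) a b c d α β γ = 0 := by
    rw [← lift_Ev]; exact mk_f k F
  have gg : Ev (mkH k G (X k)) (mkH k G (Y k)) (mkH k G (Z k)) a' b' c' d' α' β' γ' = 0 := by
    rw [← lift_Ev]; exact mk_f k G
  have e1 := Ev_subst _ _ _ gx gy p q r s t u w l h1 h2 h3 h4 h5 h6 h7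
  rw [gg, smul_zero] at e1
  let φ := hlift (p • mkH k G (X k) + q • mkH k G (Y k) + r • mkH k G (Z k))
    (s • mkH k G (X k) + t • mkH k G (Y k) + u • mkH k G (Z k)) (w • mkH k G (Z k))
    (by simp only [mul_add, add_mul, smul_mul_assoc, mul_smul_comm, gx, gy]; module)
    (by simp only [mul_add, add_mul, smul_mul_assoc, mul_smul_comm, gx, gy]; module) e1
  obtain ⟨D, hDD⟩ : ∃ D, D * (p * t - q * s) = 1 := ⟨_, inv_mul_cancel₀ hD⟩
  obtain ⟨v, hv⟩ : ∃ v, v * w = 1 := ⟨_, inv_mul_cancel₀ hw⟩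
  -- inverse substitution
  set x' := (D * t) • mkH k F (X k) + (- D * q) • mkH k F (Y k)
    + (v * D * (q * u - t * r)) • mkH k F (Z k) with hx'
  set y' := (- D * s) • mkH k F (X k) + (D * p) • mkH k F (Y k)
    + (v * D * (s * r - p * u)) • mkH k F (Z k) with hy'
  set z' := v • mkH k F (Z k) with hz'
  have ix : p • x' + q • y' + r • z' = mkH k F (X k) := by
    rw [hx', hy', hz']
    match_scalars
    · linear_combination hDD
    · ring
    · linear_combination (- r * v) * hDD
  have iy : s • x' + t • y' + u • z' = mkH k F (Y k) := by
    rw [hx', hy', hz']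
    match_scalars
    · ring
    · linear_combination hDD
    · linear_combination (- u * v) * hDD
  have iz : w • z' = mkH k F (Z k) := by
    rw [hz']
    match_scalars
    linear_combination hv
  have zx' : z' * x' = x' * z' := by
    rw [hx', hz']
    simp only [mul_add, add_mul, smul_mul_assoc, mul_smul_comm, fx, fy]; module
  have zy' : z' * y' = y' * z' := by
    rw [hy', hz']
    simp only [mul_add, add_mul, smul_mul_assoc, mul_smul_comm, fx, fy]; module
  have e2 := Ev_subst _ _ _ zx' zy' p q r s t u w l h1 h2 h3 h4 h5 h6 h7
  rw [ix, iy, iz, ff] at e2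
  have e3 := (smul_eq_zero.1 e2.symm).resolve_left hl
  let ψ := hlift x' y' z' zx' zy' e3
  have φx : φ (mkH k F (X k)) = _ := hlift_x _ _ _ _ _ _
  have φy : φ (mkH k F (Y k)) = _ := hlift_y _ _ _ _ _ _
  have φz : φ (mkH k F (Z k)) = _ := hlift_z _ _ _ _ _ _
  have ψx : ψ (mkH k G (X k)) = _ := hlift_x _ _ _ _ _ _
  have ψy : ψ (mkH k G (Y k)) = _ := hlift_y _ _ _ _ _ _
  have ψz : ψ (mkH k G (Z k)) = _ := hlift_z _ _ _ _ _ _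
  refine ⟨AlgEquiv.ofAlgHom φ ψ (hext ?_ ?_ ?_) (hext ?_ ?_ ?_)⟩
  · rw [AlgHom.comp_apply, ψx, hx', map_add, map_add, map_smul, map_smul, map_smul, φx, φy, φz,
      AlgHom.id_apply]
    match_scalars
    · linear_combination hDD
    · ring
    · linear_combination (D * (q * u - t * r)) * hv
  · rw [AlgHom.comp_apply, ψy, hy', map_add, map_add, map_smul, map_smul, map_smul, φx, φy, φz,
      AlgHom.id_apply]
    match_scalars
    · ring
    · linear_combination hDD
    · linear_combination (D * (s * r - p * u)) * hv
  · rw [AlgHom.comp_apply, ψz, hz', map_smul, φz, AlgHom.id_apply]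
    match_scalars
    linear_combination hv
  · rw [AlgHom.comp_apply, φx, map_add, map_add, map_smul, map_smul, map_smul, ψx, ψy, ψz,
      AlgHom.id_apply, ix]
  · rw [AlgHom.comp_apply, φy, map_add, map_add, map_smul, map_smul, map_smul, ψx, ψy, ψz,
      AlgHom.id_apply, iy]
  · rw [AlgHom.comp_apply, φz, map_smul, ψz, AlgHom.id_apply, iz]

/-- Isomorphism of the algebras of two coefficient tuples. -/
def Eqv {k : Type*} [Field k] (a b c d α β γ a' b' c' d' α' β' γ' : k) : Prop :=
  Nonempty (HAlg k (Ev (X k) (Y k) (Z k) a b c d α β γ) ≃ₐ[k]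
      HAlg k (Ev (X k) (Y k) (Z k) a' b' c' d' α' β' γ'))

/-- Being isomorphic to one of the normal forms. -/
def Good {k : Type*} [Field k] (a b c d α β γ : k) : Prop :=
  (∃ q, q ≠ 0 ∧ Eqv a b c d α β γ 0 1 (-q) 0 0 0 0) ∨
  (∃ q, q ≠ 0 ∧ Eqv a b c d α β γ 0 1 (-q) 0 0 0 (-1)) ∨
  Eqv a b c d α β γ 0 (-1) 1 1 0 0 0 ∨
  Eqv a b c d α β γ 0 (-1) 1 1 0 0 1 ∨
  Eqv a b c d α β γ 0 (-1) 1 0 0 1 0 ∨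
  Eqv a b c d α β γ 0 (-1) 1 1 1 0 0 ∨
  Eqv a b c d α β γ 1 0 0 0 0 0 0 ∨
  Eqv a b c d α β γ 1 0 0 0 0 0 (-1) ∨
  Eqv a b c d α β γ 0 0 1 0 0 0 0 ∨
  Eqv a b c d α β γ 0 0 1 0 0 0 (-1) ∨
  Eqv a b c d α β γ 1 0 0 0 0 1 0

theorem Good_of_Eqv {k : Type*} [Field k] {a b c d α β γ : k} (a' b' c' d' α' β' γ' : k)
    (h : Eqv a b c d α β γ a' b' c' d' α' β' γ')
    (hg : Good a' b' c' d' α' β' γ') : Good a b c d α β γ := by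
  obtain ⟨e⟩ := h
  have tr : ∀ {a₁ b₁ c₁ d₁ α₁ β₁ γ₁ : k},
      Eqv a' b' c' d' α' β' γ' a₁ b₁ c₁ d₁ α₁ β₁ γ₁ → Eqv a b c d α β γ a₁ b₁ c₁ d₁ α₁ β₁ γ₁ :=
    fun ⟨e'⟩ => ⟨e.trans e'⟩
  rcases hg with ⟨q, h, e⟩ | ⟨q, h, e⟩ | e | e | e | e | e | e | e | e | e
  · exact Or.inl ⟨q, h, tr e⟩
  · exact Or.inr (Or.inl ⟨q, h, tr e⟩)
  all_goals
    have := tr e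
    unfold Good
    tauto

section
variable {k : Type*} [Field k] [IsAlgClosed k]

theorem sq_ex (γ : k) : ∃ w, w * w = γ := by
  obtain ⟨w, hw⟩ := IsAlgClosed.exists_eq_mul_self γ
  exact ⟨w, hw.symm⟩

/-- choose `w` nonzero normalizing `γ` -/
theorem norm_ex (γ e : k) (he : e ≠ 0) (hγ : γ ≠ 0) : ∃ w, w ≠ 0 ∧ γ * w * w = e := by
  obtain ⟨w, hw⟩ := sq_ex (e / γ)
  refine ⟨w, ?_, ?_⟩
  · rintro rfl
    rw [mul_zero] at hw
    exact div_ne_zero he hγ hw.symm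
  · rw [mul_assoc, hw]; field_simp

/-- no linear terms, `b xy + c yx + γ z²` -/
theorem case_diag (b c γ : k) (h : ¬ (b = 0 ∧ c = 0)) : Good 0 b c 0 0 0 γ := by
  by_cases hb : b = 0
  · subst hb
    have hc : c ≠ 0 := fun h' => h ⟨rfl, h'⟩
    by_cases hγ : γ = 0
    · subst hγ
      iterate 8 right
      left
      apply iso_subst 1 0 0 0 1 0 1 c <;> simp [hc]
    · obtain ⟨w, hw, hw2⟩ := norm_ex γ (-c) (neg_ne_zero.2 hc) hγ
      iterate 9 right
      left
      apply iso_subst 1 0 0 0 1 0 w c <;> simp [hc, hw, hw2]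
  by_cases hc : c = 0
  · subst hc
    apply Good_of_Eqv 0 0 b 0 0 0 γ
    · apply iso_subst 0 1 0 1 0 0 1 1 <;> simp
    by_cases hγ : γ = 0
    · subst hγ
      iterate 8 right
      left
      apply iso_subst 1 0 0 0 1 0 1 b <;> simp [hb]
    · obtain ⟨w, hw, hw2⟩ := norm_ex γ (-b) (neg_ne_zero.2 hb) hγ
      iterate 9 right
      left
      apply iso_subst 1 0 0 0 1 0 w b <;> simp [hb, hw, hw2]
  by_cases hγ : γ = 0
  · subst hγ
    left
    refine ⟨-c / b, div_ne_zero (neg_ne_zero.2 hc) hb, ?_⟩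
    apply iso_subst 1 0 0 0 1 0 1 b <;> simp [hb]
    field_simp
  · obtain ⟨w, hw, hw2⟩ := norm_ex γ (-b) (neg_ne_zero.2 hb) hγ
    right; left
    refine ⟨-c / b, div_ne_zero (neg_ne_zero.2 hc) hb, ?_⟩
    apply iso_subst 1 0 0 0 1 0 w b <;> simp [hb, hw, hw2]
    field_simp

/-- nondegenerate symmetric part -/
theorem case_sym (b c d α β γ : k) (h : b + c ≠ 0) : Good 0 b c d α β γ := by
  apply Good_of_Eqv 0 b c 0 α (α * (-d / (b + c)) + β) γ
  · apply iso_subst 1 (-d / (b + c)) 0 0 1 0 1 1 <;> simp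
    field_simp
    ring
  generalize α * (-d / (b + c)) + β = β'
  obtain ⟨i, hi⟩ : ∃ i, (b + c) * i = 1 := ⟨_, mul_inv_cancel₀ h⟩
  apply Good_of_Eqv 0 b c 0 0 0 (γ - α * β' * i)
  · apply iso_subst 1 0 (-β' * i) 0 1 (-α * i) 1 1 <;> simp
    · linear_combination (α) * hi
    · linear_combination (β') * hi
    · linear_combination (- α * β' * i) * hi
  apply case_diag
  rintro ⟨rfl, rfl⟩
  simp at h

/-- `yx - xy + linear` -/
theorem case_comm (α β γ : k) : Good 0 (-1) 1 0 α β γ := by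
  by_cases hβ : β = 0
  · by_cases hα : α = 0
    · subst hα hβ
      apply case_diag
      simp
    · subst hβ
      iterate 4 right
      left
      apply iso_subst 0 1 (γ/(α*α)) 1 0 0 (-1/α) (-1) <;> simp [hα]
      field_simp
      ring
  · iterate 4 right
    left
    apply iso_subst 1 0 0 (-α/β) 1 (-γ/β * (1 / β)) (1/β) 1 <;> simp [hβ] <;> (try field_simp) <;> ring

theorem case_jordan [CharZero k] (α β γ : k) : Good 0 (-1) 1 1 α β γ := by
  apply Good_of_Eqv 0 (-1) 1 1 α 0 (γ - β * β / 4)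
  · apply iso_subst 1 0 0 0 1 (-β/2) 1 1 <;> simp
    · ring
    · ring
  generalize γ - β * β / 4 = γ'
  by_cases hα : α = 0
  · subst hα
    by_cases hγ : γ' = 0
    · subst hγ
      right; right; left
      apply iso_subst 1 0 0 0 1 0 1 1 <;> simp
    · obtain ⟨w, hw, hw2⟩ := norm_ex γ' 1 one_ne_zero hγ
      right; right; right; left
      apply iso_subst 1 0 0 0 1 0 w 1 <;> simp [hw, hw2]
  · iterate 5 right
    left
    apply iso_subst 1 0 (-γ'/α*(1/α)) 0 1 0 (1/α) 1 <;> simp [hα]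
    field_simp
    ring

theorem case_sq [CharZero k] (α β γ : k) : Good 1 0 0 0 α β γ := by
  apply Good_of_Eqv 1 0 0 0 0 β (γ - α * α / 4)
  · apply iso_subst 1 0 (-α/2) 0 1 0 1 1 <;> simp
    · ring
    · ring
  generalize γ - α * α / 4 = γ'
  by_cases hβ : β = 0
  · subst hβ
    by_cases hγ : γ' = 0
    · subst hγ
      iterate 6 right
      left
      apply iso_subst 1 0 0 0 1 0 1 1 <;> simp
    · obtain ⟨w, hw, hw2⟩ := norm_ex γ' (-1) (by simp) hγ
      iterate 7 right
      left
      apply iso_subst 1 0 0 0 1 0 w 1 <;> simp [hw, hw2]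
  · iterate 10 right
    apply iso_subst 1 0 0 0 1 (-γ'/β*(1/β)) (1/β) 1 <;> simp [hβ]
    field_simp
    ring

theorem case_a0 [CharZero k] (b c d α β γ : k) (h : ¬ (b = 0 ∧ c = 0 ∧ d = 0)) :
    Good 0 b c d α β γ := by
  by_cases hs : b + c = 0
  swap
  · exact case_sym b c d α β γ hs
  obtain rfl : b = -c := by linear_combination hs
  by_cases hc : c = 0
  · subst hc
    have hd : d ≠ 0 := by simpa using h
    apply Good_of_Eqv 1 0 0 0 (β / d) (α / d) (γ / d)
    · apply iso_subst 0 1 0 1 0 0 1 d <;> simp [hd] <;> field_simp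
    apply case_sq
  by_cases hd : d = 0
  · subst hd
    apply Good_of_Eqv 0 (-1) 1 0 (α / c) (β / c) (γ / c)
    · apply iso_subst 1 0 0 0 1 0 1 c <;> simp [hc] <;> field_simp
    apply case_comm
  · apply Good_of_Eqv 0 (-1) 1 1 (α / c) (β / d) (γ / d)
    · apply iso_subst (d/c) 0 0 0 1 0 1 d <;> simp [hc, hd] <;> field_simp
    apply case_jordan

theorem case_all [CharZero k] (a b c d α β γ : k)
    (h : ¬ (a = 0 ∧ b = 0 ∧ c = 0 ∧ d = 0)) : Good a b c d α β γ := by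
  by_cases ha : a = 0
  · subst ha
    apply case_a0
    simpa using h
  obtain ⟨w, hw⟩ := sq_ex ((b + c) * (b + c) - 4 * a * d)
  -- root of a p² + (b+c) p + d
  obtain ⟨p, hp⟩ : ∃ p, p = (w - (b + c)) / (2 * a) := ⟨_, rfl⟩
  have hp' : a * p * p + b * p + c * p + d = 0 := by
    subst hp
    field_simp
    linear_combination hw
  apply Good_of_Eqv 0 (a * p + c) (a * p + b) a (α * p + β) α γ
  · apply iso_subst p 1 0 1 0 0 1 1 <;> simp
    linear_combination -hp'
  apply case_a0
  rintro ⟨-, -, h⟩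
  exact ha h

end

theorem Eqv_conv {k : Type*} [Field k] {a b c d α β γ a' b' c' d' α' β' γ' : k}
    {f g : FreeAlgebra k (Fin 3)}
    (h : Eqv a b c d α β γ a' b' c' d' α' β' γ')
    (hf : f = Ev (X k) (Y k) (Z k) a b c d α β γ)
    (hg : Ev (X k) (Y k) (Z k) a' b' c' d' α' β' γ' = g) : Nonempty (HAlg k f ≃ₐ[k] HAlg k g) := by
  subst hf hg
  exact h

theorem stmt_19 (k : Type*) [Field k] [IsAlgClosed k] [CharZero k]
    (a b c d α β γ : k) (hdeg : ¬(a = 0 ∧ b = 0 ∧ c = 0 ∧ d = 0))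
    (f : FreeAlgebra k (Fin 3))
    (hf : f = a • (X k * X k) + b • (X k * Y k) + c • (Y k * X k) + d • (Y k * Y k)
      + α • (X k * Z k) + β • (Y k * Z k) + γ • (Z k * Z k)) :
    (∃ q : k, q ≠ 0 ∧
      Nonempty (HAlg k f ≃ₐ[k] HAlg k (X k * Y k - q • (Y k * X k)))) ∨
    (∃ q : k, q ≠ 0 ∧
      Nonempty (HAlg k f ≃ₐ[k] HAlg k (X k * Y k - q • (Y k * X k) - Z k * Z k))) ∨
    Nonempty (HAlg k f ≃ₐ[k] HAlg k (Y k * X k - X k * Y k + Y k * Y k)) ∨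
    Nonempty (HAlg k f ≃ₐ[k] HAlg k (Y k * X k - X k * Y k + Y k * Y k + Z k * Z k)) ∨
    Nonempty (HAlg k f ≃ₐ[k] HAlg k (Y k * X k - X k * Y k + Y k * Z k)) ∨
    Nonempty (HAlg k f ≃ₐ[k] HAlg k (Y k * X k - X k * Y k + Y k * Y k + X k * Z k)) ∨
    Nonempty (HAlg k f ≃ₐ[k] HAlg k (X k * X k)) ∨
    Nonempty (HAlg k f ≃ₐ[k] HAlg k (X k * X k - Z k * Z k)) ∨
    Nonempty (HAlg k f ≃ₐ[k] HAlg k (Y k * X k)) ∨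
    Nonempty (HAlg k f ≃ₐ[k] HAlg k (Y k * X k - Z k * Z k)) ∨
    Nonempty (HAlg k f ≃ₐ[k] HAlg k (X k * X k + Y k * Z k)) := by
  have hf' : f = Ev (X k) (Y k) (Z k) a b c d α β γ := hf
  rcases case_all a b c d α β γ hdeg with
    ⟨q, h, e⟩ | ⟨q, h, e⟩ | e | e | e | e | e | e | e | e | e
  · exact Or.inl ⟨q, h, Eqv_conv e hf' (by unfold Ev; module)⟩
  · exact Or.inr (Or.inl ⟨q, h, Eqv_conv e hf' (by unfold Ev; module)⟩)
  · iterate 2 right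
    left
    exact Eqv_conv e hf' (by unfold Ev; module)
  · iterate 3 right
    left
    exact Eqv_conv e hf' (by unfold Ev; module)
  · iterate 4 right
    left
    exact Eqv_conv e hf' (by unfold Ev; module)
  · iterate 5 right
    left
    exact Eqv_conv e hf' (by unfold Ev; module)
  · iterate 6 right
    left
    exact Eqv_conv e hf' (by unfold Ev; module)
  · iterate 7 right
    left
    exact Eqv_conv e hf' (by unfold Ev; module)
  · iterate 8 right
    left
    exact Eqv_conv e hf' (by unfold Ev; module)
  · iterate 9 right
    left
    exact Eqv_conv e hf' (by unfold Ev; module)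
  · iterate 10 right
    exact Eqv_conv e hf' (by unfold Ev; module)
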